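/- arXiv:1804.02532 — 3 statements merged into one kernel-verified Lean document; each statement's English description precedes it below -/
import Mathlib

section
/- In the Knödel graph W_{Δ,n} with Δ ≥ 2, for any two distinct vertices u_i and u_j of U with 1 ≤ i < j ≤ n/2, |N(u_i) ∩ N(u_j)| = 1 if and only if precisely one of the two values id(u_i, u_j) and n/2 − id(u_i, u_j) belongs to M_Δ. -/
/-- The Knödel graph `W_{Δ,n}` (here `m = n/2`): a bipartite graph on the vertex set
`Bool × ZMod m`, where `(false, i)` plays the role of `u_i` and `(true, j)` the role of `v_j`,
and `u_i` is adjacent to `v_j` iff `j ≡ i + 2^k - 1 (mod m)` for some `0 ≤ k ≤ Δ - 1`. -/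
def knodel (Δ m : ℕ) : SimpleGraph (Bool × ZMod m) :=
  SimpleGraph.fromRel (fun a b =>
    a.1 = false ∧ b.1 = true ∧ ∃ k < Δ, b.2 = a.2 + 2 ^ k - 1)

/-- The index-distance between (the indices of) two vertices `u_i` and `u_j`
of the Knödel graph on `2m` vertices: `id(u_i,u_j) = min{|i-j|, m - |i-j|}`. -/
def idist (m i j : ℕ) : ℕ := min (Nat.dist i j) (m - Nat.dist i j)

/-- The set `M_Δ = {2^a - 2^b : 0 ≤ b < a ≤ Δ - 1}`. -/
def Mset (Δ : ℕ) : Set ℕ := {x | ∃ a b : ℕ, b < a ∧ a < Δ ∧ x = 2 ^ a - 2 ^ b}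

theorem two_pow_sub_unique {d a b a' b' : ℕ} (hd : 0 < d) (h : 2 ^ a = d + 2 ^ b)
    (h' : 2 ^ a' = d + 2 ^ b') : a = a' ∧ b = b' := by
  have bound : ∀ {x y : ℕ}, 2 ^ x = d + 2 ^ y → d < 2 ^ x ∧ 2 ^ x ≤ 2 * d := by
    intro x y hxy
    have hlt : y < x := (Nat.pow_lt_pow_iff_right (a := 2) (by norm_num)).1 (by omega)
    have hle : 2 ^ (y + 1) ≤ 2 ^ x := Nat.pow_le_pow_right (by norm_num) hlt
    have hy : 0 < 2 ^ y := by positivity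
    rw [pow_succ] at hle
    omega
  have le : ∀ {x y : ℕ}, d < 2 ^ x → 2 ^ y ≤ 2 * d → y ≤ x := by
    intro x y hx hy
    have : 2 ^ y < 2 ^ (x + 1) := by rw [pow_succ]; omega
    have := (Nat.pow_lt_pow_iff_right (a := 2) (by norm_num)).1 this
    omega
  have ha : a = a' :=
    le_antisymm (le (bound h').1 (bound h).2) (le (bound h).1 (bound h').2)
  subst ha
  exact ⟨rfl, Nat.pow_right_injective le_rfl (by simp only; omega)⟩

theorem mem_Mset_iff {Δ d : ℕ} (hd : 0 < d) :
    d ∈ Mset Δ ↔ ∃ a < Δ, ∃ b < Δ, 2 ^ a = d + 2 ^ b := by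
  constructor
  · rintro ⟨a, b, hba, ha, rfl⟩
    have : 2 ^ b ≤ 2 ^ a := Nat.pow_le_pow_right (by norm_num) hba.le
    exact ⟨a, ha, b, by omega, by omega⟩
  · rintro ⟨a, ha, b, -, h⟩
    exact ⟨a, b, (Nat.pow_lt_pow_iff_right (a := 2) (by norm_num)).1 (by omega), ha, by omega⟩

theorem natCast_add_eq_iff {m i j p q : ℕ} (hij : i < j) (hjm : j < i + m)
    (hp : 0 < p) (hpm : p ≤ m) (hq : 0 < q) (hqm : q ≤ m) :
    (i : ZMod m) + p = j + q ↔ p = (j - i) + q ∨ q = (m - (j - i)) + p := by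
  have key : (i : ZMod m) + p = j + q ↔ (m : ℤ) ∣ (j + q) - (i + p) := by
    rw [← Int.modEq_iff_dvd, ← ZMod.intCast_eq_intCast_iff]
    push_cast
    rfl
  rw [key]
  constructor
  · rintro ⟨c, hc⟩
    have h1 : -1 < c := by
      by_contra h
      have : (m : ℤ) * c ≤ m * (-1) := mul_le_mul_of_nonneg_left (by omega) (by omega)
      omega
    have h2 : c < 2 := by
      by_contra h
      have : (m : ℤ) * 2 ≤ m * c := mul_le_mul_of_nonneg_left (by omega) (by omega)
      omega
    interval_cases c <;> omega
  · rintro (h | h)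
    · exact ⟨0, by omega⟩
    · exact ⟨1, by omega⟩

theorem knodel_adj_false_iff {Δ m : ℕ} (x : ZMod m) (w : Bool × ZMod m) :
    (knodel Δ m).Adj (false, x) w ↔ ∃ k < Δ, w = (true, x + 2 ^ k - 1) := by
  obtain ⟨c, y⟩ := w
  cases c <;> simp [knodel, SimpleGraph.fromRel_adj]

theorem two_pow_injOn_zmod {Δ m : ℕ} (hm : ∀ k < Δ, 2 ^ k ≤ m) (x : ZMod m) :
    Set.InjOn (fun k : ℕ => ((true, x + 2 ^ k - 1) : Bool × ZMod m)) {k | k < Δ} := by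
  intro a ha b hb h
  have h : (2 : ZMod m) ^ a = 2 ^ b := by simpa using h
  have h : ((2 ^ a : ℕ) : ZMod m) = ((2 ^ b : ℕ) : ZMod m) := by exact_mod_cast h
  rw [ZMod.natCast_eq_natCast_iff, Nat.modEq_iff_dvd] at h
  have ha' := hm a ha
  have hb' := hm b hb
  have pa : 0 < 2 ^ a := by positivity
  have pb : 0 < 2 ^ b := by positivity
  have := Int.eq_zero_of_abs_lt_dvd h (by rw [abs_lt]; omega)
  exact Nat.pow_right_injective le_rfl (by simp only; omega)

/-- Common neighbors of `u_i` and `u_j`, parametrized by the exponent of the edge from `u_i`. -/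
theorem knodel_commonNeighbors_eq {Δ m i j : ℕ} (hm : ∀ k < Δ, 2 ^ k ≤ m)
    (hij : i < j) (hjm : j < i + m) :
    (knodel Δ m).neighborSet (false, (i : ZMod m)) ∩
      (knodel Δ m).neighborSet (false, (j : ZMod m)) =
    (fun k : ℕ => ((true, i + 2 ^ k - 1) : Bool × ZMod m)) ''
      ({k | k < Δ ∧ ∃ l < Δ, 2 ^ k = (j - i) + 2 ^ l} ∪
        {k | k < Δ ∧ ∃ l < Δ, 2 ^ l = (m - (j - i)) + 2 ^ k}) := by
  have key : ∀ k < Δ, ∀ l < Δ, ((i : ZMod m) + 2 ^ k - 1 = j + 2 ^ l - 1 ↔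
      2 ^ k = (j - i) + 2 ^ l ∨ 2 ^ l = (m - (j - i)) + 2 ^ k) := by
    intro k hk l hl
    rw [← natCast_add_eq_iff hij hjm (by positivity) (hm k hk) (by positivity) (hm l hl)]
    push_cast
    exact sub_left_inj
  ext w
  simp only [Set.mem_inter_iff, SimpleGraph.mem_neighborSet, knodel_adj_false_iff, Set.mem_image,
    Set.mem_union, Set.mem_ofPred_eq]
  constructor
  · rintro ⟨⟨k, hk, rfl⟩, l, hl, h⟩
    refine ⟨k, ?_, rfl⟩
    rcases (key k hk l hl).1 (Prod.mk.inj h).2 with h | h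
    · exact Or.inl ⟨hk, l, hl, h⟩
    · exact Or.inr ⟨hk, l, hl, h⟩
  · rintro ⟨k, ⟨hk, l, hl, h⟩ | ⟨hk, l, hl, h⟩, rfl⟩
    · exact ⟨⟨k, hk, rfl⟩, l, hl, by rw [(key k hk l hl).2 (Or.inl h)]⟩
    · exact ⟨⟨k, hk, rfl⟩, l, hl, by rw [(key k hk l hl).2 (Or.inr h)]⟩

theorem Set.ncard_union_eq_one_iff_xor {α : Type*} {A B : Set α} (hA : A.Subsingleton)
    (hB : B.Subsingleton) (hAB : Disjoint A B) :
    (A ∪ B).ncard = 1 ↔ Xor A.Nonempty B.Nonempty := by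
  rw [Set.ncard_union_eq hAB hA.finite hB.finite]
  rcases hA.eq_empty_or_singleton with rfl | ⟨a, rfl⟩ <;>
    rcases hB.eq_empty_or_singleton with rfl | ⟨b, rfl⟩ <;> simp [Xor]

/-- Corollary 1 (i): in `W_{Δ,n}` with `Δ ≥ 2`, for `1 ≤ i < j ≤ n/2`, the vertices `u_i, u_j`
have exactly one common neighbor iff precisely one of `id(u_i,u_j)` and `n/2 - id(u_i,u_j)`
belongs to `M_Δ`. -/
theorem knodel_stmt_5 (n Δ : ℕ) (hn : Even n) (hn2 : 2 ≤ n)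
    (hΔ : 2 ≤ Δ) (hΔ' : Δ ≤ Nat.log 2 n)
    (i j : ℕ) (hi1 : 1 ≤ i) (hij : i < j) (hj2 : j ≤ n / 2) :
    ((knodel Δ (n / 2)).neighborSet (false, (i : ZMod (n / 2))) ∩
      (knodel Δ (n / 2)).neighborSet (false, (j : ZMod (n / 2)))).ncard = 1 ↔
    Xor' (idist (n / 2) i j ∈ Mset Δ) (n / 2 - idist (n / 2) i j ∈ Mset Δ) := by
  have hm : ∀ k < Δ, 2 ^ k ≤ n / 2 := by
    intro k hk
    have h1 : 2 ^ (k + 1) ≤ 2 ^ Nat.log 2 n := Nat.pow_le_pow_right (by norm_num) (by omega)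
    have h2 := Nat.pow_log_le_self 2 (x := n) (by omega)
    rw [pow_succ] at h1
    omega
  generalize n / 2 = m at *
  have hd : 0 < j - i := by omega
  have hd' : 0 < m - (j - i) := by omega
  rw [knodel_commonNeighbors_eq hm hij (by omega), Set.InjOn.ncard_image
    ((two_pow_injOn_zmod hm _).mono (Set.union_subset (fun _ h => h.1) fun _ h => h.1)),
    Set.ncard_union_eq_one_iff_xor]
  · have hA : {k | k < Δ ∧ ∃ l < Δ, 2 ^ k = (j - i) + 2 ^ l}.Nonempty ↔ j - i ∈ Mset Δ :=
      (mem_Mset_iff hd).symm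
    have hB : {k | k < Δ ∧ ∃ l < Δ, 2 ^ l = (m - (j - i)) + 2 ^ k}.Nonempty ↔
        m - (j - i) ∈ Mset Δ := by
      rw [mem_Mset_iff hd']
      exact ⟨fun ⟨k, hk, l, hl, h⟩ => ⟨l, hl, k, hk, h⟩,
        fun ⟨l, hl, k, hk, h⟩ => ⟨k, hk, l, hl, h⟩⟩
    rw [hA, hB, idist, Nat.dist_eq_sub_of_le hij.le]
    rcases le_total (j - i) (m - (j - i)) with h | h
    · rw [min_eq_left h]
      exact Iff.rfl
    · rw [min_eq_right h, Nat.sub_sub_self (by omega)]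
      exact iff_of_eq (xor_comm _ _)
  · rintro k ⟨-, l, -, h⟩ k' ⟨-, l', -, h'⟩
    exact (two_pow_sub_unique hd h h').1
  · rintro k ⟨-, l, -, h⟩ k' ⟨-, l', -, h'⟩
    exact (two_pow_sub_unique hd' h h').2
  · rw [Set.disjoint_left]
    rintro k ⟨-, l, -, h⟩ ⟨-, l', hl', h'⟩
    have := hm l' hl'
    have : 0 < 2 ^ l := by positivity
    omega
end

section
/- In the Knödel graph W_{Δ,n} with Δ ≥ 2, for any nonempty subset A ⊆ U, at most Δ·|A| − |N(A)| elements of the cyclic-sequence of A belong to M_Δ. -/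
/-- If a set `T` of points of a finite domain is such that every point of `T` shares its value
under `f` with a point of smaller rank, then `T` may be dropped without changing the image of `f`. -/
theorem Finset.image_sdiff_eq_of_exists_rank_lt {α β : Type*} [Fintype α] [DecidableEq α]
    [DecidableEq β] (f : α → β) (rank : α → ℕ) (T : Finset α)
    (hT : ∀ p ∈ T, ∃ q, f q = f p ∧ rank q < rank p) :
    (Finset.univ \ T).image f = Finset.univ.image f := by
  refine (Finset.image_subset_image Finset.sdiff_subset).antisymm fun v hv => ?_
  obtain ⟨p, -, rfl⟩ := Finset.mem_image.mp hv
  clear hv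
  induction h : rank p using Nat.strong_induction_on generalizing p with
  | _ r ih =>
    by_cases hp : p ∈ T
    · obtain ⟨q, hq, hlt⟩ := hT p hp
      exact hq ▸ ih (rank q) (h ▸ hlt) q rfl
    · exact Finset.mem_image_of_mem f (by simp [hp])

/-- The neighbors of a vertex `u_x` of the Knödel graph are the `v_y` with `y = x + 2^a - 1`. -/
theorem knodel_adj_false {Δ m : ℕ} {x : ZMod m} {w : Bool × ZMod m}
    (h : (knodel Δ m).Adj (false, x) w) : ∃ a < Δ, w = (true, x + 2 ^ a - 1) := by
  obtain ⟨b, y⟩ := w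
  rw [knodel, SimpleGraph.fromRel_adj] at h
  rcases h with ⟨-, ⟨-, hb, a, ha, hy⟩ | ⟨-, hb, -⟩⟩
  · exact ⟨a, ha, Prod.ext hb hy⟩
  · simp at hb

/-- Lemma 4 (ii): in `W_{Δ,n}` with `Δ ≥ 2`, for any nonempty subset
`A = {u_{i_1} < ⋯ < u_{i_k}} ⊆ U`, at most `Δ·|A| - |N(A)|` elements of the cyclic-sequence
of `A` belong to `M_Δ`. -/
theorem knodel_stmt_11 (n Δ k : ℕ) (hn : Even n) (hn2 : 2 ≤ n)
    (hΔ : 2 ≤ Δ) (hΔ' : Δ ≤ Nat.log 2 n) (hk : 0 < k)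
    (i : Fin k → ℕ) (hmono : StrictMono i)
    (h1 : 1 ≤ i ⟨0, hk⟩) (h2 : i ⟨k - 1, Nat.sub_lt hk one_pos⟩ ≤ n / 2)
    (ns : Fin k → ℕ)
    (hns : ∀ j : Fin k, ns j =
      if h : (j : ℕ) + 1 < k then i ⟨(j : ℕ) + 1, h⟩ - i j
      else n / 2 + i ⟨0, hk⟩ - i j)
    (A : Set (Bool × ZMod (n / 2)))
    (hA : A = {w | ∃ j : Fin k, w = (false, ((i j : ℕ) : ZMod (n / 2)))}) :
    {j : Fin k | ns j ∈ Mset Δ}.ncard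
      ≤ Δ * k - (⋃ u ∈ A, (knodel Δ (n / 2)).neighborSet u).ncard := by
  classical
  have hm : 0 < n / 2 := by omega
  have : NeZero (n / 2) := ⟨hm.ne'⟩
  subst hA
  generalize n / 2 = m at *
  set G : Set (Fin k) := {j | ns j ∈ Mset Δ}
  let f : Fin k × Fin Δ → Bool × ZMod m := fun p => (true, (i p.1 : ZMod m) + 2 ^ (p.2 : ℕ) - 1)
  have hle : ∀ j, i j ≤ m := fun j =>
    (hmono.monotone (Fin.le_def.mpr (by dsimp only; omega))).trans h2
  have hnext : ∀ j, ∃ j', (i j' : ZMod m) = i j + ns j := by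
    intro j
    by_cases h : (j : ℕ) + 1 < k
    · have hlt : i j < i ⟨j + 1, h⟩ := hmono (Fin.lt_def.mpr (Nat.lt_succ_self _))
      refine ⟨⟨j + 1, h⟩, ?_⟩
      rw [hns j, dif_pos h, ← Nat.cast_add, Nat.add_sub_cancel' hlt.le]
    · refine ⟨⟨0, hk⟩, ?_⟩
      rw [hns j, dif_neg h, ← Nat.cast_add, Nat.add_sub_cancel' (le_add_right (hle j))]
      simp
  have hcoll : ∀ j ∈ G, ∃ a : Fin Δ, ∃ q : Fin k × Fin Δ, f q = f (j, a) ∧ (q.2 : ℕ) < a := by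
    rintro j ⟨a, b, hba, ha, hj⟩
    obtain ⟨j', hj'⟩ := hnext j
    refine ⟨⟨a, ha⟩, (j', ⟨b, hba.trans ha⟩), Prod.ext rfl ?_, hba⟩
    have hpow : ns j + 2 ^ b = 2 ^ a := by
      rw [hj]
      exact Nat.sub_add_cancel (Nat.pow_le_pow_right two_pos hba.le)
    have hcast : (ns j : ZMod m) + 2 ^ b = 2 ^ a := by exact_mod_cast congrArg Nat.cast hpow
    simp only [f, hj', ← hcast]
    ring
  have : Nonempty (Fin Δ) := ⟨⟨0, two_pos.trans_le hΔ⟩⟩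
  choose! a ha using hcoll
  let T : Finset (Fin k × Fin Δ) := G.toFinset.image fun j => (j, a j)
  have hTcard : T.card = G.ncard := by
    rw [Set.ncard_eq_toFinset_card']
    exact Finset.card_image_of_injective _ fun x y h => (Prod.ext_iff.mp h).1
  have himage := Finset.image_sdiff_eq_of_exists_rank_lt f (fun p => (p.2 : ℕ)) T (by
    intro p hp
    obtain ⟨j, hj, rfl⟩ := Finset.mem_image.mp hp
    exact ha j (Set.mem_toFinset.mp hj))
  have hsub : (⋃ u ∈ {w : Bool × ZMod m | ∃ j : Fin k, w = (false, (i j : ZMod m))},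
      (knodel Δ m).neighborSet u) ⊆ ((Finset.univ \ T).image f : Finset _) := by
    rw [himage]
    intro w hw
    simp only [Set.mem_iUnion] at hw
    obtain ⟨_, ⟨j, rfl⟩, hw⟩ := hw
    obtain ⟨c, hc, rfl⟩ := knodel_adj_false hw
    exact Finset.mem_coe.mpr (Finset.mem_image_of_mem f (Finset.mem_univ (j, (⟨c, hc⟩ : Fin Δ))))
  have hN := (Set.ncard_le_ncard hsub (Finset.finite_toSet _)).trans
    ((Set.ncard_coe_finset _).trans_le Finset.card_image_le)
  have hcard := Finset.card_sdiff_add_card_eq_card (Finset.subset_univ T)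
  rw [Finset.card_univ, Fintype.card_prod, Fintype.card_fin, Fintype.card_fin, mul_comm,
    hTcard] at hcard
  omega
end

section
/- For every integer t ≥ 1, the total domination number of the cubic Knödel graph W_{3,10t} equals 4t. -/
/-- The total domination number of a graph `G`: the minimum cardinality of a (finite) set `D`
of vertices such that every vertex of `G` has a neighbor in `D`. -/
noncomputable def totalDominationNumber {V : Type*} (G : SimpleGraph V) : ℕ :=
  sInf {k | ∃ D : Set V, D.Finite ∧ D.ncard = k ∧ ∀ v, ∃ d ∈ D, G.Adj v d}

/-- A set meeting every translate of `{0, -1, -3}` in `ZMod m` has density at least `2 / 5`. -/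
theorem two_mul_le_five_mul_card_of_cover {m : ℕ} [NeZero m] (S : Finset (ZMod m))
    (hS : ∀ x, x ∈ S ∨ x - 1 ∈ S ∨ x - 3 ∈ S) : 2 * m ≤ 5 * S.card := by
  classical
  let f : ZMod m → ℕ := fun x => if x ∈ S then 1 else 0
  let c : ZMod m → ℕ := fun x => f x + f (x - 1) + f (x - 3)
  let h : ZMod m → ℕ := fun x => if 2 ≤ c x then 1 else 0
  have hf : ∑ x, f x = S.card := by simp [f]
  have hshift : ∀ (g : ZMod m → ℕ) (a : ZMod m), ∑ x, g (x - a) = ∑ x, g x := fun g a =>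
    Equiv.sum_comp (Equiv.subRight a) g
  have hc : ∑ x, c x = 3 * S.card := by
    simp only [c, Finset.sum_add_distrib, hshift f, hf]
    ring
  have overlap : ∀ s, f s ≤ f s * (h s + h (s + 1) + h (s + 3)) := by
    intro s
    by_cases hs : s ∈ S
    · have e1 : s + 2 - 1 = s + 1 := by ring
      have e2 : s + 2 - 3 = s - 1 := by ring
      have e3 : s + 3 - 1 = s + 2 := by ring
      have h2 := hS (s + 2)
      rw [e1, e2] at h2
      have hfs : f s = 1 := by simp [f, hs]
      suffices h s = 1 ∨ h (s + 1) = 1 ∨ h (s + 3) = 1 by rw [hfs]; omega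
      rcases h2 with h2 | h2 | h2
      · have : f (s + 2) = 1 := by simp [f, h2]
        right; right
        simp only [h, c, e3, add_sub_cancel_right]
        rw [if_pos]; omega
      · have : f (s + 1) = 1 := by simp [f, h2]
        right; left
        simp only [h, c, add_sub_cancel_right]
        rw [if_pos]; omega
      · have : f (s - 1) = 1 := by simp [f, h2]
        left
        simp only [h, c]
        rw [if_pos]; omega
    · simp [f, hs]
  have double_count : ∑ s, f s * (h s + h (s + 1) + h (s + 3)) = ∑ x, c x * h x := by
    have h1 := hshift (fun s => f s * h (s + 1)) 1
    have h3 := hshift (fun s => f s * h (s + 3)) 3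
    simp only [sub_add_cancel] at h1 h3
    simp only [c, mul_add, add_mul, Finset.sum_add_distrib, h1, h3]
  have excess : ∀ x, c x * h x + 2 ≤ 2 * c x := by
    intro x
    have : 1 ≤ c x := by
      rcases hS x with hx | hx | hx <;> simp only [c, f, if_pos hx] <;> omega
    simp only [h]
    split_ifs <;> omega
  have h1 := Finset.sum_le_sum fun s (_ : s ∈ Finset.univ) => overlap s
  have h2 := Finset.sum_le_sum fun x (_ : x ∈ Finset.univ) => excess x
  rw [hf, double_count] at h1
  rw [Finset.sum_add_distrib, ← Finset.mul_sum, hc] at h2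
  simp only [Finset.sum_const, Finset.card_univ, ZMod.card, smul_eq_mul] at h2
  omega

theorem knodel_three_adj_false_true {m : ℕ} (i j : ZMod m) :
    (knodel 3 m).Adj (false, i) (true, j) ↔ j = i ∨ j = i + 1 ∨ j = i + 3 := by
  have e : i + 2 ^ 2 - 1 = i + 3 := by ring
  have e' : i + 2 - 1 = i + 1 := by ring
  have hk (p : ℕ → Prop) : (∃ k < 3, p k) ↔ p 0 ∨ p 1 ∨ p 2 := by
    simp only [Nat.exists_lt_succ_right, Nat.not_lt_zero, false_and, exists_false, false_or,
      or_assoc]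
  simp only [knodel, SimpleGraph.fromRel_adj, hk]
  simp [e, e']

theorem knodel_not_adj_same_side {Δ m : ℕ} (b : Bool) (i j : ZMod m) :
    ¬ (knodel Δ m).Adj (b, i) (b, j) := by
  cases b <;> simp [knodel, SimpleGraph.fromRel_adj]

theorem four_mul_le_five_mul_ncard_of_total_dominating {m : ℕ} [NeZero m]
    (D : Set (Bool × ZMod m)) (hD : ∀ v, ∃ d ∈ D, (knodel 3 m).Adj v d) :
    4 * m ≤ 5 * D.ncard := by
  classical
  let A : Finset (ZMod m) := {i | (false, i) ∈ D}
  let B : Finset (ZMod m) := {i | (true, -i) ∈ D}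
  have hA : 2 * m ≤ 5 * A.card := by
    refine two_mul_le_five_mul_card_of_cover A fun x => ?_
    obtain ⟨⟨b, i⟩, hd, hadj⟩ := hD (true, x)
    cases b
    · rw [SimpleGraph.adj_comm, knodel_three_adj_false_true] at hadj
      rcases hadj with rfl | rfl | rfl <;> simp [A, hd]
    · exact absurd hadj (knodel_not_adj_same_side _ _ _)
  have hB : 2 * m ≤ 5 * B.card := by
    refine two_mul_le_five_mul_card_of_cover B fun x => ?_
    obtain ⟨⟨b, j⟩, hd, hadj⟩ := hD (false, -x)
    cases b
    · exact absurd hadj (knodel_not_adj_same_side _ _ _)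
    · rw [knodel_three_adj_false_true] at hadj
      simp only [B, Finset.mem_filter_univ, sub_eq_neg_add, neg_add_rev, neg_neg]
      rcases hadj with rfl | rfl | rfl <;> simp [hd]
  have hcard : A.card + B.card ≤ D.ncard := by
    rw [Set.ncard_eq_toFinset_card', ← Finset.card_disjSum]
    refine Finset.card_le_card_of_injOn
      (Sum.elim (fun i => (false, i)) (fun i => (true, -i))) ?_ ?_
    · rintro (i | i) hi <;> simpa [A, B] using hi
    · rintro (i | i) - (j | j) - hij <;> simp_all
  omega

theorem exists_total_dominating_knodel_three {t : ℕ} (ht : 1 ≤ t) :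
    ∃ D : Set (Bool × ZMod (5 * t)), D.Finite ∧ D.ncard ≤ 4 * t ∧
      ∀ v, ∃ d ∈ D, (knodel 3 (5 * t)).Adj v d := by
  have : NeZero (5 * t) := ⟨by omega⟩
  let φ : ZMod (5 * t) →+* ZMod 5 := ZMod.castHom (dvd_mul_right 5 t) (ZMod 5)
  let D : Set (Bool × ZMod (5 * t)) := {p | φ p.2 = 0 ∨ φ p.2 = 1}
  refine ⟨D, Set.toFinite D, ?_, ?_⟩
  · let F : Bool × Fin 2 × Fin t → Bool × ZMod (5 * t) :=
      fun p => (p.1, ((5 * p.2.2 + p.2.1 : ℕ) : ZMod (5 * t)))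
    have hsub : D ⊆ F '' Set.univ := by
      rintro ⟨b, i⟩ hi
      have hlt := ZMod.val_lt i
      have hφ : φ i = (i.val : ZMod 5) := by
        conv_lhs => rw [← ZMod.natCast_zmod_val i, map_natCast]
      have hmod : i.val % 5 < 2 := by
        rcases hi with hi | hi <;> rw [hφ] at hi
        · rw [ZMod.natCast_eq_zero_iff] at hi
          omega
        · rw [← Nat.cast_one, ZMod.natCast_eq_natCast_iff'] at hi
          omega
      refine ⟨(b, ⟨i.val % 5, hmod⟩, ⟨i.val / 5, by omega⟩), trivial, ?_⟩
      simp only [F, Nat.div_add_mod, ZMod.natCast_zmod_val]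
    calc D.ncard ≤ (F '' Set.univ).ncard := Set.ncard_le_ncard hsub
      _ ≤ (Set.univ : Set (Bool × Fin 2 × Fin t)).ncard := Set.ncard_image_le
      _ = 4 * t := by simp [Set.ncard_univ]; ring
  · rintro ⟨b, x⟩
    cases b
    · have key : ∀ y : ZMod 5, (y = 0 ∨ y = 1) ∨ (y + 1 = 0 ∨ y + 1 = 1) ∨
          (y + 3 = 0 ∨ y + 3 = 1) := by decide
      rcases key (φ x) with hx | hx | hx
      · exact ⟨(true, x), hx, by simp [knodel_three_adj_false_true]⟩
      · exact ⟨(true, x + 1), by simpa [D] using hx, by simp [knodel_three_adj_false_true]⟩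
      · exact ⟨(true, x + 3), by simpa only [D, Set.mem_ofPred_eq, map_add, map_ofNat] using hx,
          by simp [knodel_three_adj_false_true]⟩
    · have key : ∀ y : ZMod 5, (y = 0 ∨ y = 1) ∨ (y - 1 = 0 ∨ y - 1 = 1) ∨
          (y - 3 = 0 ∨ y - 3 = 1) := by decide
      simp only [SimpleGraph.adj_comm _ (true, x)]
      rcases key (φ x) with hx | hx | hx
      · exact ⟨(false, x), hx, by simp [knodel_three_adj_false_true]⟩
      · exact ⟨(false, x - 1), by simpa only [D, Set.mem_ofPred_eq, map_sub, map_one] using hx,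
          by simp [knodel_three_adj_false_true]⟩
      · exact ⟨(false, x - 3), by simpa only [D, Set.mem_ofPred_eq, map_sub, map_ofNat] using hx,
          by simp [knodel_three_adj_false_true]⟩

/-- Case 1: for every `t ≥ 1`, the total domination number of `W_{3,10t}` equals `4t`. -/
theorem knodel_stmt_13 (t : ℕ) (ht : 1 ≤ t) :
    totalDominationNumber (knodel 3 ((10 * t) / 2)) = 4 * t := by
  have hm : 10 * t / 2 = 5 * t := by omega
  rw [hm]
  have : NeZero (5 * t) := ⟨by omega⟩
  obtain ⟨D, hfin, hcard, hD⟩ := exists_total_dominating_knodel_three ht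
  refine le_antisymm (le_trans (Nat.sInf_le ?_) hcard) ?_
  · exact ⟨D, hfin, rfl, hD⟩
  obtain ⟨E, -, hE_card, hE⟩ := Nat.sInf_mem (s := {k | ∃ D : Set (Bool × ZMod (5 * t)),
    D.Finite ∧ D.ncard = k ∧ ∀ v, ∃ d ∈ D, (knodel 3 (5 * t)).Adj v d}) ⟨_, D, hfin, rfl, hD⟩
  rw [totalDominationNumber, ← hE_card]
  have := four_mul_le_five_mul_ncard_of_total_dominating E hE
  omega
end
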